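/- Let A be a unital complex Banach *-algebra and let δ : A → A be a bounded linear map satisfying δ({a b c}) = {δ(a) b c} + {a δ(b) c} + {a b δ(c)} for all a, b, c ∈ A, where {a b c} = (a b* c + c b* a)/2. Then δ is the sum of a Jordan *-derivation and an inner triple derivation: the map δ₁ : x ↦ δ(1) ∘ x (where x ∘ y = (xy + yx)/2) is an inner triple derivation, and δ₀ := δ − δ₁ satisfies δ₀(1) = 0, δ₀(x ∘ y) = δ₀(x) ∘ y + x ∘ δ₀(y), and δ₀(x*) = δ₀(x)* for all x, y ∈ A. -/

import Mathlib

/-- The Jordan triple product `{a b c} = (a b* c + c b* a)/2` on a complex *-algebra. -/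
noncomputable def tripleProd {A : Type*} [NonUnitalRing A] [Module ℂ A] [Star A] (a b c : A) : A :=
  (2⁻¹ : ℂ) • (a * star b * c + c * star b * a)

/-- The Jordan product `x ∘ y = (xy + yx)/2` on a complex algebra. -/
noncomputable def jordanProd {A : Type*} [NonUnitalRing A] [Module ℂ A] (x y : A) : A :=
  (2⁻¹ : ℂ) • (x * y + y * x)

/-- The value at `1` of a triple derivation is skew-adjoint. -/
theorem star_map_one_of_tripleDerivation {A : Type*} [Ring A] [Module ℂ A] [StarRing A] (δ : A → A)
    (hder : ∀ a b c : A,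
      δ (tripleProd a b c) = tripleProd (δ a) b c + tripleProd a (δ b) c + tripleProd a b (δ c)) :
    star (δ 1) = -δ 1 := by
  have h := hder 1 1 1
  have h1 : tripleProd (1 : A) 1 1 = 1 := by
    simp only [tripleProd, star_one, mul_one]
    module
  rw [h1] at h
  simp only [tripleProd, star_one, mul_one, one_mul] at h
  have key : δ 1 = δ 1 + (star (δ 1) + δ 1) := by
    refine h.trans ?_
    module
  exact eq_neg_of_add_eq_zero_left (left_eq_add.mp key)

/-- Every triple derivation `δ` of a unital complex Banach *-algebra is the sum of a
Jordan *-derivation and an inner triple derivation: the map `δ₁ : x ↦ δ(1) ∘ x` is an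
inner triple derivation, and `δ₀ := δ - δ₁` vanishes at `1`, is a Jordan derivation,
and is *-preserving. -/
theorem stmt_13 {A : Type*} [NormedRing A] [NormedAlgebra ℂ A] [CompleteSpace A]
    [StarRing A] [StarModule ℂ A]
    (δ : A →L[ℂ] A)
    (hder : ∀ a b c : A,
      δ (tripleProd a b c) = tripleProd (δ a) b c + tripleProd a (δ b) c + tripleProd a b (δ c)) :
    (∃ (n : ℕ) (p q : Fin n → A),
      ∀ x : A, jordanProd (δ 1) x = ∑ i, (tripleProd (p i) (q i) x - tripleProd (q i) (p i) x)) ∧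
    (∀ x y : A, δ (jordanProd x y) - jordanProd (δ 1) (jordanProd x y) =
      jordanProd (δ x - jordanProd (δ 1) x) y + jordanProd x (δ y - jordanProd (δ 1) y)) ∧
    (∀ x : A, δ (star x) - jordanProd (δ 1) (star x) = star (δ x - jordanProd (δ 1) x)) ∧
    (δ 1 - jordanProd (δ 1) 1 = 0) := by
  have hskew := star_map_one_of_tripleDerivation δ hder
  refine ⟨⟨1, fun _ => (2⁻¹ : ℂ) • δ 1, fun _ => 1, fun x => ?_⟩, fun x y => ?_, fun x => ?_, ?_⟩
  · simp only [Fin.sum_univ_one, tripleProd, jordanProd, star_smul, hskew, star_one, mul_one,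
      one_mul, star_inv₀, star_ofNat, smul_mul_assoc, mul_smul_comm, mul_neg, neg_mul, smul_neg]
    module
  · have h := hder x 1 y
    have hxy : tripleProd x 1 y = jordanProd x y := by
      simp only [tripleProd, jordanProd, star_one, mul_one]
    rw [hxy] at h
    rw [h]
    simp only [tripleProd, jordanProd, hskew, star_one, mul_one, mul_add, add_mul, mul_sub, sub_mul,
      smul_mul_assoc, mul_smul_comm, mul_neg, neg_mul, mul_assoc]
    module
  · have h := hder 1 x 1
    have hx : tripleProd 1 x 1 = star x := by
      simp only [tripleProd, mul_one, one_mul]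
      module
    rw [hx] at h
    rw [h]
    simp only [tripleProd, jordanProd, star_sub, star_smul, star_add, star_mul, hskew, star_inv₀,
      star_ofNat, mul_one, one_mul, mul_neg, neg_mul]
    module
  · simp only [jordanProd, mul_one, one_mul]
    module
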